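/- Let G=(N,E) and G'=(N,E') be DAGs on the same node set, with each state space X_s having at least two elements, and let O' be a topological ordering of G'. Then P^{G'} ⊇ P^G if and only if for every s ∈ N, {s} ⊥_G pr^{O'}(s) | pa_{G'}(s). -/

import Mathlib

open Finset

/-! Basic graph-theoretic definitions for Bayesian networks. -/

/-- Two nodes are joined (adjacent) in the directed graph `E`. -/
def GJoined {V : Type*} (E : V → V → Prop) (a b : V) : Prop := E a b ∨ E b a

/-- A directed graph (given by its edge relation) is a DAG iff it has no cycles:
no node can reach itself by a nonempty directed walk. -/
def IsDAG {V : Type*} (E : V → V → Prop) : Prop := ∀ s, ¬ Relation.TransGen E s s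

/-- The set of parents of `s`. -/
def paG {V : Type*} (E : V → V → Prop) (s : V) : Set V := {t | E t s}

/-- The set of children of `s`. -/
def chG {V : Type*} (E : V → V → Prop) (s : V) : Set V := {t | E s t}

/-- The set of descendants of `s` (nodes reachable from `s` by a nonempty directed path). -/
def desG {V : Type*} (E : V → V → Prop) (s : V) : Set V := {t | Relation.TransGen E s t}

/-- A set of nodes is complete if all pairs of distinct elements are joined. -/
def GComplete {V : Type*} (E : V → V → Prop) (S : Set V) : Prop :=
  ∀ a ∈ S, ∀ b ∈ S, a ≠ b → GJoined E a b

/-- A directed graph is perfect if the parent set of every node is complete. -/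
def GPerfect {V : Type*} (E : V → V → Prop) : Prop := ∀ s, GComplete E (paG E s)

/-- `a` and `b` are joined in the moral graph `G^M` of `E`:
either joined in `E` or distinct common parents of some node. -/
def MoralEdge {V : Type*} (E : V → V → Prop) (a b : V) : Prop :=
  E a b ∨ E b a ∨ (a ≠ b ∧ ∃ s, E a s ∧ E b s)

/-- A topological ordering of a graph on a finite node set: an injective map into
`{1, …, |N|}` (encoded as `Fin (card V)`) increasing along edges. -/
def IsTopo {V : Type*} [Fintype V] (E : V → V → Prop) (O : V → Fin (Fintype.card V)) : Prop :=
  Function.Injective O ∧ ∀ s t, E s t → O s < O t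

/-! d-separation. -/

/-- `u` is a v-structure (collider) of the trail `l` in the graph `E`. -/
def VStruct {V : Type*} (E : V → V → Prop) (l : List V) (u : V) : Prop :=
  ∃ l₁ l₂ a b, l = l₁ ++ a :: u :: b :: l₂ ∧ E a u ∧ E b u

/-- `l` is a trail in the graph `E`: a nonempty sequence of distinct nodes consecutively joined. -/
def IsTrail {V : Type*} (E : V → V → Prop) (l : List V) : Prop :=
  l ≠ [] ∧ l.Nodup ∧ l.Chain' (GJoined E)

/-- The trail `l` is blocked by `S`. -/
def BlockedBy {V : Type*} (E : V → V → Prop) (S : Set V) (l : List V) : Prop :=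
  ∃ u ∈ l, (u ∈ S ∧ ¬ VStruct E l u) ∨
    (VStruct E l u ∧ u ∉ S ∧ ∀ t ∈ desG E u, t ∉ S)

/-- d-separation: every trail from a node of `A` to a node of `B` is blocked by `S`. -/
def DSep {V : Type*} (E : V → V → Prop) (A B S : Set V) : Prop :=
  ∀ (l : List V) (a b : V), IsTrail E l → l.head? = some a → l.getLast? = some b →
    a ∈ A → b ∈ B → BlockedBy E S l

/-- The set of leaves (childless nodes), as a `Finset`. -/
def leavesF {V : Type*} [Fintype V] (E : V → V → Prop) [DecidableRel E] : Finset V :=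
  Finset.univ.filter fun s => ∀ t, ¬ E s t

/-! Probability on graphs (finite state spaces, pmfs). -/

section Prob

variable {V : Type*} [Fintype V] [DecidableEq V]
variable (X : V → Type*) [∀ v, Fintype (X v)]

/-- `p` is a probability mass function on `X_N = ∏ v, X v`. -/
def IsPMF (p : (∀ v, X v) → ℝ) : Prop :=
  (∀ x, 0 ≤ p x) ∧ ∑ x, p x = 1

/-- `k` is a kernel function for the node `s` w.r.t. the graph `E`: it is nonnegative,
depends on the configuration only through the parents of `s` in `E`, and is normalized. -/
def IsKernel (E : V → V → Prop) (s : V) (k : X s → (∀ v, X v) → ℝ) : Prop :=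
  (∀ a x, 0 ≤ k a x) ∧
  (∀ a x y, (∀ t, E t s → x t = y t) → k a x = k a y) ∧
  (∀ x, ∑ a, k a x = 1)

/-- `p` factorizes over the graph `E`: it is a product of kernel functions, one per node. -/
def Factorizes (E : V → V → Prop) (p : (∀ v, X v) → ℝ) : Prop :=
  ∃ k : ∀ s, X s → (∀ v, X v) → ℝ,
    (∀ s, IsKernel X E s (k s)) ∧ ∀ x, p x = ∏ s, k s (x s) x

variable [∀ v, DecidableEq (X v)]

/-- The marginal of `p` on the coordinates in `C`, evaluated at (the `C`-part of) `x`. -/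
def marg (p : (∀ v, X v) → ℝ) (C : Finset V) (x : ∀ v, X v) : ℝ :=
  ∑ y, if ∀ v ∈ C, y v = x v then p y else 0

/-- Conditional independence `A ⟂⟂ B ∣ S` w.r.t. the pmf `p`. -/
def CondIndep (p : (∀ v, X v) → ℝ) (A B S : Finset V) : Prop :=
  ∀ x, 0 < marg X p S x →
    marg X p (A ∪ B ∪ S) x * marg X p S x = marg X p (A ∪ S) x * marg X p (B ∪ S) x

/-- `q` is a conditional system for `N ∖ A` given `A`: a family of pmfs on `X_{N∖A}`,
one for every configuration on `A`.  Here `q x` encodes `q(x_{N∖A} ∣ x_A)`. -/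
def IsCondSystem (A : Finset V) (q : (∀ v, X v) → ℝ) : Prop :=
  (∀ x, 0 ≤ q x) ∧ ∀ x : ∀ v, X v, (∑ y, if ∀ v ∈ A, y v = x v then q y else 0) = 1

/-- The conditional system `q` for `N ∖ A` given `A` factorizes over the graph `E`. -/
def CondFactorizes (E : V → V → Prop) (A : Finset V) (q : (∀ v, X v) → ℝ) : Prop :=
  ∃ k : ∀ s, X s → (∀ v, X v) → ℝ,
    (∀ s ∉ A, IsKernel X E s (k s)) ∧ ∀ x, q x = ∏ s ∈ Finset.univ \ A, k s (x s) x

/-- The conditional system `q` for `N ∖ A` given `A` is a version of the conditional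
distribution of the pmf `p`. -/
def IsVersionOf (A : Finset V) (q p : (∀ v, X v) → ℝ) : Prop :=
  ∀ x, p x = q x * marg X p A x

/-- `G'` (edges `E'`) satisfies Goal I for `G` (edges `E`): `roots(G') ⊇ leaves(G)` and for
every pmf factorizing over `G` there is a conditional system for `N ∖ leaves(G)` given
`leaves(G)` factorizing over `G'` which is a version of its conditional distribution. -/
def GoalI (E E' : V → V → Prop) [DecidableRel E] : Prop :=
  (∀ s ∈ leavesF E, ∀ t, ¬ E' t s) ∧
  ∀ p : (∀ v, X v) → ℝ, IsPMF X p → Factorizes X E p →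
    ∃ q, IsCondSystem X (leavesF E) q ∧ CondFactorizes X E' (leavesF E) q ∧
      IsVersionOf X (leavesF E) q p

/-- `G'` (edges `E'`) satisfies Goal II for `G` (edges `E`): `P^{G'} ⊇ P^G` and every parent
in `G'` of a leaf of `G` is itself a leaf of `G`. -/
def GoalII (E E' : V → V → Prop) : Prop :=
  (∀ p : (∀ v, X v) → ℝ, IsPMF X p → Factorizes X E p → Factorizes X E' p) ∧
  ∀ s t, (∀ u, ¬ E s u) → E' t s → ∀ u, ¬ E t u

end Prob

section ActiveWalks

variable {V : Type*} {E : V → V → Prop} {S : Set V}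

/-- There is a directed path of length `h` from `v` to `S` that meets `S` only at its end. -/
inductive Descent (E : V → V → Prop) (S : Set V) : ℕ → V → Prop
  | mem {v : V} : v ∈ S → Descent E S 0 v
  | step {h : ℕ} {v w : V} : v ∉ S → E v w → Descent E S h w → Descent E S (h + 1) v

/-- There is a directed path of length `m` from `c` to `x` avoiding `S`, except perhaps at `x`. -/
inductive DirPath (E : V → V → Prop) (S : Set V) (c : V) : ℕ → V → Prop
  | refl : DirPath E S c 0 c
  | snoc {m : ℕ} {x w : V} : DirPath E S c m x → x ∉ S → E x w → DirPath E S c (m + 1) w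

/-- `ActiveTo E S t k v d`: there is an `S`-active walk of cost `k` from `v` to `t`. The flag `d`
records whether `v` was entered along an edge pointing to `v`; passing a collider costs the length
of a descent from it to `S`, and every edge of the walk costs one. -/
inductive ActiveTo (E : V → V → Prop) (S : Set V) (t : V) : ℕ → V → Bool → Prop
  | done (d : Bool) : ActiveTo E S t 0 t d
  | pass {k : ℕ} {v w : V} (d : Bool) :
      v ∉ S → E v w → ActiveTo E S t k w true → ActiveTo E S t (k + 1) v d
  | climb {k : ℕ} {v w : V} :
      v ∉ S → E w v → ActiveTo E S t k w false → ActiveTo E S t (k + 1) v false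
  | turn {k h : ℕ} {v w : V} :
      Descent E S h v → E w v → ActiveTo E S t k w false → ActiveTo E S t (k + 1 + h) v true

theorem Descent.mem_or_exists_desG {h : ℕ} {v : V} (hv : Descent E S h v) :
    v ∈ S ∨ ∃ t ∈ desG E v, t ∈ S := by
  induction hv with
  | mem h => exact Or.inl h
  | step _ hE _ ih =>
    right
    rcases ih with ih | ⟨t, ht, htS⟩
    · exact ⟨_, Relation.TransGen.single hE, ih⟩
    · exact ⟨t, Relation.TransGen.head hE ht, htS⟩

theorem exists_descent_of_reflTransGen {v t : V} (hvt : Relation.ReflTransGen E v t) (ht : t ∈ S) :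
    ∃ h, Descent E S h v := by
  induction hvt using Relation.ReflTransGen.head_induction_on with
  | refl => exact ⟨0, .mem ht⟩
  | @head a b hE _ ih =>
    by_cases ha : a ∈ S
    · exact ⟨0, .mem ha⟩
    · obtain ⟨h, hh⟩ := ih
      exact ⟨h + 1, .step ha hE hh⟩

theorem DirPath.start_notMem {c x : V} {m : ℕ} (hp : DirPath E S c m x) (hx : x ∉ S) : c ∉ S := by
  induction hp with
  | refl => exact hx
  | snoc _ hx' _ ih => exact ih hx'

theorem ActiveTo.of_dirPath {t c x : V} {k m : ℕ} (hp : DirPath E S c m x)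
    (hx : ActiveTo E S t k x true) : ActiveTo E S t (k + m) c true := by
  induction hp generalizing k with
  | refl => exact hx
  | @snoc m x w _ hxS hE ih =>
    have := ih (.pass true hxS hE hx)
    rwa [show k + 1 + m = k + (m + 1) by omega] at this

theorem ActiveTo.climb_dirPath {t c x : V} {k m : ℕ} (hp : DirPath E S c m x) (hx : x ∉ S)
    (hc : ActiveTo E S t k c false) : ActiveTo E S t (k + m) x false := by
  induction hp with
  | refl => exact hc
  | snoc _ hxS hE ih => exact .climb hx hE (ih hxS)

theorem ActiveTo.false_of_true {t x : V} {k : ℕ} (hx : x ∉ S) (ha : ActiveTo E S t k x true) :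
    ∃ k' ≤ k, ActiveTo E S t k' x false := by
  cases ha with
  | done => exact ⟨0, le_rfl, .done _⟩
  | pass _ h1 h2 h3 => exact ⟨_, le_rfl, .pass _ h1 h2 h3⟩
  | turn h1 h2 h3 => exact ⟨_, Nat.le_add_right _ _, .climb hx h2 h3⟩

theorem ActiveTo.true_of_false {t x : V} {k h : ℕ} (hd : Descent E S h x)
    (ha : ActiveTo E S t k x false) : ∃ k' ≤ k + h, ActiveTo E S t k' x true := by
  cases ha with
  | done => exact ⟨0, Nat.zero_le _, .done _⟩
  | pass _ h1 h2 h3 => exact ⟨_, Nat.le_add_right _ _, .pass _ h1 h2 h3⟩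
  | climb h1 h2 h3 => exact ⟨_, le_rfl, .turn hd h2 h3⟩

/-- One step of an active walk; `r` and `r'` are the costs still to be paid before and after. -/
def ActiveStep (E : V → V → Prop) (S : Set V) (v v' : V) (d d' : Bool) (r r' : ℕ) : Prop :=
  (v ∉ S ∧ E v v' ∧ d' = true ∧ r = r' + 1) ∨
  (v ∉ S ∧ E v' v ∧ d = false ∧ d' = false ∧ r = r' + 1) ∨
  (∃ h, Descent E S h v ∧ E v' v ∧ d = true ∧ d' = false ∧ r = r' + 1 + h)

/-- `v 0, …, v n` is a cheapest `S`-active walk from `s` to `t`. -/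
structure ShortestWalk (E : V → V → Prop) (S : Set V) (t : V)
    (n : ℕ) (v : ℕ → V) (d : ℕ → Bool) (r : ℕ → ℕ) : Prop where
  last : v n = t
  active : ∀ i ≤ n, ActiveTo E S t (r i) (v i) (d i)
  le : ∀ i ≤ n, ∀ j, ActiveTo E S t j (v i) (d i) → r i ≤ j
  step : ∀ i < n, ActiveStep E S (v i) (v (i + 1)) (d i) (d (i + 1)) (r i) (r (i + 1))

theorem ShortestWalk.cons {t x w : V} {b e : Bool} {k k' n : ℕ} {v : ℕ → V} {d : ℕ → Bool}
    {r : ℕ → ℕ} (hw : ShortestWalk E S t n v d r) (hv : v 0 = w) (hd : d 0 = e) (hr : r 0 = k')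
    (hx : ActiveTo E S t k x b) (hmin : ∀ j, ActiveTo E S t j x b → k ≤ j)
    (hstep : ActiveStep E S x w b e k k') :
    ∃ v' d' r', ShortestWalk E S t (n + 1) v' d' r' ∧ v' 0 = x ∧ d' 0 = b := by
  refine ⟨fun i => i.casesOn x v, fun i => i.casesOn b d, fun i => i.casesOn k r,
    ⟨hw.last, ?_, ?_, ?_⟩, rfl, rfl⟩
  · rintro (_ | i) hi
    · exact hx
    · exact hw.active i (by omega)
  · rintro (_ | i) hi
    · exact hmin
    · exact hw.le i (by omega)
  · rintro (_ | i) hi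
    · subst hv hd hr
      exact hstep
    · exact hw.step i (by omega)

theorem exists_shortestWalk_of_min {t : V} (k : ℕ) :
    ∀ (x : V) (b : Bool), ActiveTo E S t k x b → (∀ j, ActiveTo E S t j x b → k ≤ j) →
      ∃ n v d r, ShortestWalk E S t n v d r ∧ v 0 = x ∧ d 0 = b := by
  induction k using Nat.strong_induction_on with
  | _ k ih =>
    intro x b hx hmin
    have key : ∀ k' < k, ∀ w e, ActiveTo E S t k' w e → ActiveStep E S x w b e k k' →
        (∀ j, ActiveTo E S t j w e → k' ≤ j) →
        ∃ n v d r, ShortestWalk E S t n v d r ∧ v 0 = x ∧ d 0 = b := by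
      intro k' hk' w e hw hs hm
      obtain ⟨n, v, d, r, hW, hv, hd⟩ := ih k' hk' w e hw hm
      have hr : r 0 = k' := by
        apply le_antisymm
        · exact hW.le 0 (Nat.zero_le _) _ (by rw [hv, hd]; exact hw)
        · exact hm _ (by have := hW.active 0 (Nat.zero_le _); rwa [hv, hd] at this)
      obtain ⟨v', d', r', h⟩ := hW.cons hv hd hr hx hmin hs
      exact ⟨n + 1, v', d', r', h⟩
    cases hx with
    | done =>
      exact ⟨0, fun _ => t, fun _ => b, fun _ => 0,
        ⟨rfl, fun _ _ => .done b, fun _ _ _ _ => Nat.zero_le _,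
          fun i hi => absurd hi (Nat.not_lt_zero i)⟩, rfl, rfl⟩
    | @pass k' _ w _ h1 h2 h3 =>
      refine key k' (by omega) w true h3 (Or.inl ⟨h1, h2, rfl, rfl⟩) fun j hj => ?_
      have := hmin _ (.pass b h1 h2 hj)
      omega
    | @climb k' _ w h1 h2 h3 =>
      refine key k' (by omega) w false h3 (Or.inr (Or.inl ⟨h1, h2, rfl, rfl, rfl⟩)) fun j hj => ?_
      have := hmin _ (.climb h1 h2 hj)
      omega
    | @turn k' h _ w h1 h2 h3 =>
      refine key k' (by omega) w false h3 (Or.inr (Or.inr ⟨h, h1, h2, rfl, rfl, rfl⟩))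
        fun j hj => ?_
      have := hmin _ (.turn h1 h2 hj)
      omega

theorem exists_shortestWalk {t x : V} {b : Bool} (hx : ∃ k, ActiveTo E S t k x b) :
    ∃ n v d r, ShortestWalk E S t n v d r ∧ v 0 = x ∧ d 0 = b := by
  classical
  exact exists_shortestWalk_of_min (Nat.find hx) x b (Nat.find_spec hx)
    fun j hj => Nat.find_min' hx hj

namespace ShortestWalk

variable {t : V} {n : ℕ} {v : ℕ → V} {d : ℕ → Bool} {r : ℕ → ℕ}

theorem cost_lt (hw : ShortestWalk E S t n v d r) {i j : ℕ} (hij : i < j) (hj : j ≤ n) :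
    r j < r i := by
  induction j, hij using Nat.le_induction with
  | base =>
    change r (i + 1) < r i
    rcases hw.step i (by omega) with h | h | ⟨_, h⟩ <;> omega
  | succ j hij ih =>
    have := ih (by omega)
    rcases hw.step j (by omega) with h | h | ⟨_, h⟩ <;> omega

theorem notMem (hw : ShortestWalk E S t n v d r) (ht : t ∉ S) {i : ℕ} (hi : i ≤ n)
    (hc : ¬ (i < n ∧ d i = true ∧ d (i + 1) = false)) : v i ∉ S := by
  rcases hi.eq_or_lt with rfl | hi
  · rwa [hw.last]
  · rcases hw.step i hi with h | h | ⟨_, h⟩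
    · exact h.1
    · exact h.1
    · exact absurd ⟨hi, h.2.2.1, h.2.2.2.1⟩ hc

theorem exists_descent (hw : ShortestWalk E S t n v d r) {i j : ℕ} (hij : i < j) (hj : j ≤ n)
    (hdi : d i = true) (hdj : d j = false) : ∃ h, Descent E S h (v i) ∧ r j + h + 1 ≤ r i := by
  obtain ⟨l, rfl⟩ := Nat.exists_eq_add_of_lt hij
  induction l generalizing i with
  | zero =>
    rcases hw.step i (by omega) with h | h | ⟨a, h⟩
    · simp_all
    · simp_all
    · exact ⟨a, h.1, by simp only [Nat.add_zero]; omega⟩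
  | succ l ih =>
    rcases hw.step i (by omega) with h | h | ⟨a, h⟩
    · have e : i + 1 + l + 1 = i + (l + 1) + 1 := by omega
      obtain ⟨a, ha, hle⟩ := ih (i := i + 1) h.2.2.1 (by omega) (by omega) (by rwa [e])
      exact ⟨a + 1, .step h.1 h.2.1 ha, by rw [e] at hle; omega⟩
    · simp_all
    · have := hw.cost_lt (i := i + 1) (j := i + (l + 1) + 1) (by omega) hj
      exact ⟨a, h.1, by omega⟩

theorem ne_of_lt (hw : ShortestWalk E S t n v d r) {i j : ℕ} (hij : i < j) (hj : j ≤ n) :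
    v i ≠ v j := by
  intro hv
  have hlt := hw.cost_lt hij hj
  have hA := hw.active j hj
  have hmin := hw.le i (by omega)
  rw [← hv] at hA
  cases hi : d i <;> cases hj' : d j <;> rw [hi] at hmin <;> rw [hj'] at hA
  · have := hmin _ hA
    omega
  · have hS : v i ∉ S := by
      rcases hw.step i (by omega) with h | h | ⟨_, h⟩
      · exact h.1
      · exact h.1
      · simp_all
    obtain ⟨k, hk, hA'⟩ := hA.false_of_true hS
    have := hmin _ hA'
    omega
  · obtain ⟨h, hh, hle⟩ := hw.exists_descent hij hj hi hj'
    obtain ⟨k, hk, hA'⟩ := hA.true_of_false hh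
    have := hmin _ hA'
    omega
  · have := hmin _ hA
    omega

theorem eq_of_eq (hw : ShortestWalk E S t n v d r) {i j : ℕ} (hi : i ≤ n) (hj : j ≤ n)
    (h : v i = v j) : i = j := by
  rcases lt_trichotomy i j with hij | hij | hij
  · exact absurd h (hw.ne_of_lt hij hj)
  · exact hij
  · exact absurd h.symm (hw.ne_of_lt hij hi)

/-- Descents of minimal length from the colliders of a shortest walk avoid its non-colliders. -/
theorem ne_of_dirPath (hw : ShortestWalk E S t n v d r) (ht : t ∉ S) {i j m h : ℕ} {x : V}
    (hi : i < n) (hdi : d i = true) (hdi' : d (i + 1) = false)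
    (hr : r i = r (i + 1) + 1 + (m + h)) (hp : DirPath E S (v i) m x) (hx : Descent E S h x)
    (hj : j ≤ n) (hc : ¬ (j < n ∧ d j = true ∧ d (j + 1) = false)) : v j ≠ x := by
  rintro rfl
  have hjS : v j ∉ S := hw.notMem ht hj hc
  rcases lt_trichotomy i j with hij | rfl | hij
  · have hle : r j ≤ r (i + 1) := by
      rcases (show i + 1 ≤ j from hij).eq_or_lt with rfl | hlt
      · exact le_rfl
      · exact (hw.cost_lt hlt hj).le
    obtain ⟨k, hk, hA⟩ : ∃ k ≤ r j + h, ActiveTo E S t k (v j) true := by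
      have hA := hw.active j hj
      cases hdj : d j <;> rw [hdj] at hA
      · exact hA.true_of_false hx
      · exact ⟨_, Nat.le_add_right _ _, hA⟩
    have := hw.le i hi.le _ (by rw [hdi]; exact hA.of_dirPath hp)
    omega
  · exact hc ⟨hi, hdi, hdi'⟩
  · have hlt := hw.cost_lt hij hi.le
    have hE : E (v (i + 1)) (v i) := by
      rcases hw.step i hi with h | h | ⟨_, h⟩
      · simp_all
      · exact h.2.1
      · exact h.2.1
    have hA := hw.active (i + 1) hi
    rw [hdi'] at hA
    have hA' := ActiveTo.climb_dirPath hp hjS (.climb (hp.start_notMem hjS) hE hA)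
    have hmin := hw.le j hj
    cases hdj : d j <;> rw [hdj] at hmin
    · have := hmin _ hA'
      omega
    · obtain ⟨k, hk, hA''⟩ := hA'.true_of_false hx
      have := hmin _ hA''
      omega

end ShortestWalk

theorem vStruct_iff {l : List V} {u : V} : VStruct E l u ↔
    ∃ (i : ℕ) (h : i + 2 < l.length), u = l[i + 1] ∧ E l[i] l[i + 1] ∧ E l[i + 2] l[i + 1] := by
  constructor
  · rintro ⟨l₁, l₂, a, b, rfl, h1, h2⟩
    refine ⟨l₁.length, by simp, ?_⟩
    simp [h1, h2]
  · rintro ⟨i, hi, rfl, h1, h2⟩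
    refine ⟨l.take i, l.drop (i + 3), l[i], l[i + 2], ?_, h1, h2⟩
    conv_lhs => rw [← List.take_append_drop i l]
    rw [List.drop_eq_getElem_cons (by omega), List.drop_eq_getElem_cons (by omega),
      List.drop_eq_getElem_cons (by omega)]

theorem IsDAG.asymm (hE : IsDAG E) {a b : V} (hab : E a b) : ¬ E b a := fun hba =>
  hE a (.tail (.single hab) hba)

theorem ShortestWalk.exists_trail {t : V} {n : ℕ} {v : ℕ → V} {d : ℕ → Bool} {r : ℕ → ℕ}
    (hw : ShortestWalk E S t n v d r) (hE : IsDAG E) (ht : t ∉ S) (hd : d 0 = false) :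
    ∃ l, IsTrail E l ∧ l.head? = some (v 0) ∧ l.getLast? = some t ∧ ¬ BlockedBy E S l := by
  have hlen : ((List.range (n + 1)).map v).length = n + 1 := by simp
  refine ⟨(List.range (n + 1)).map v, ⟨by simp, ?_, ?_⟩, ?_, ?_, ?_⟩
  · refine List.Nodup.map_on ?_ List.nodup_range
    intro i hi j hj h
    rw [List.mem_range] at hi hj
    exact hw.eq_of_eq (by omega) (by omega) h
  · refine List.isChain_iff_getElem.2 fun i hi => ?_
    rw [hlen] at hi
    simp only [List.getElem_map, List.getElem_range]
    rcases hw.step i (by omega) with h | h | ⟨_, h⟩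
    · exact Or.inl h.2.1
    · exact Or.inr h.2.1
    · exact Or.inr h.2.1
  · simp [List.range_succ_eq_map]
  · simp [List.range_succ, hw.last]
  · rintro ⟨u, hu, ⟨huS, hV⟩ | ⟨hV, huS, hdes⟩⟩
    · obtain ⟨i, hi, rfl⟩ := List.mem_map.1 hu
      rw [List.mem_range] at hi
      by_cases hc : i < n ∧ d i = true ∧ d (i + 1) = false
      · obtain ⟨hin, h1, h2⟩ := hc
        obtain _ | i := i
        · simp_all
        refine hV (vStruct_iff.2 ⟨i, by rw [hlen]; omega, ?_⟩)
        simp only [List.getElem_map, List.getElem_range, true_and]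
        constructor
        · rcases hw.step i (by omega) with h | h | ⟨_, h⟩
          · exact h.2.1
          · simp_all
          · simp_all
        · rcases hw.step (i + 1) (by omega) with h | h | ⟨_, h⟩
          · simp_all
          · exact h.2.1
          · exact h.2.1
      · exact hw.notMem ht (by omega) hc huS
    · obtain ⟨i, hi, rfl, h1, h2⟩ := vStruct_iff.1 hV
      rw [hlen] at hi
      simp only [List.getElem_map, List.getElem_range] at h1 h2 huS hdes
      have hd1 : d (i + 1) = true := by
        rcases hw.step i (by omega) with h | h | ⟨_, h⟩
        · exact h.2.2.1
        · exact absurd h.2.1 (hE.asymm h1)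
        · exact absurd h.2.1 (hE.asymm h1)
      rcases hw.step (i + 1) (by omega) with h | h | ⟨a, h⟩
      · exact hE.asymm h2 h.2.1
      · simp_all
      · rcases h.1.mem_or_exists_desG with h | ⟨x, hx, hxS⟩
        · exact huS h
        · exact hdes x hx hxS

theorem exists_activeTo_of_trail {l : List V} (hE : IsDAG E) (hl : IsTrail E l)
    (hb : ¬ BlockedBy E S l) {s t : V} (hs : l.head? = some s) (ht : l.getLast? = some t) :
    s ∉ S ∧ t ∉ S ∧ ∃ k, ActiveTo E S t k s false := by
  obtain ⟨hne, hnd, hch⟩ := hl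
  have hpos : 0 < l.length := List.length_pos_iff.2 hne
  have hs' : l[0] = s := by
    rw [List.head?_eq_getElem?, List.getElem?_eq_getElem hpos] at hs
    exact Option.some.inj hs
  have ht' : l[l.length - 1] = t := by
    rw [List.getLast?_eq_getElem?, List.getElem?_eq_getElem (by omega)] at ht
    exact Option.some.inj ht
  have hch' : ∀ (i : ℕ) (h : i + 1 < l.length), GJoined E l[i] l[i + 1] :=
    fun i h => List.isChain_iff_getElem.1 hch i h
  have notMem_of : ∀ (i : ℕ) (h : i < l.length), ¬ VStruct E l l[i] → l[i] ∉ S :=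
    fun i h hV hS => hb ⟨_, List.getElem_mem h, Or.inl ⟨hS, hV⟩⟩
  have descent_of : ∀ (i : ℕ) (h : i < l.length), VStruct E l l[i] →
      ∃ a, Descent E S a l[i] := by
    intro i h hV
    by_cases hS : l[i] ∈ S
    · exact ⟨0, .mem hS⟩
    · by_contra hno
      refine hb ⟨_, List.getElem_mem h, Or.inr ⟨hV, hS, fun x hx hxS => hno ?_⟩⟩
      exact exists_descent_of_reflTransGen (Relation.TransGen.to_reflTransGen hx) hxS
  have vStruct_at : ∀ (i : ℕ) (h : i < l.length), VStruct E l l[i] →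
      ∃ (j : ℕ) (hj : j + 2 < l.length), i = j + 1 ∧ E l[j] l[j + 1] ∧ E l[j + 2] l[j + 1] := by
    intro i h hV
    obtain ⟨j, hj, he, h1, h2⟩ := vStruct_iff.1 hV
    exact ⟨j, hj, (List.Nodup.getElem_inj_iff hnd).1 he, h1, h2⟩
  have main : ∀ (m i : ℕ) (h : i < l.length), i + m + 1 = l.length → ∀ d : Bool,
      (d = true ↔ ∃ j, ∃ hj : j + 1 < l.length, i = j + 1 ∧ E l[j] l[j + 1]) →
      ∃ k, ActiveTo E S t k l[i] d := by
    intro m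
    induction m with
    | zero =>
      intro i h hi d _
      obtain rfl : i = l.length - 1 := by omega
      rw [ht']
      exact ⟨0, .done d⟩
    | succ m ih =>
      intro i h hi d hd
      have hi1 : i + 1 < l.length := by omega
      by_cases hEi : E l[i] l[i + 1]
      · obtain ⟨k, hk⟩ := ih (i + 1) hi1 (by omega) true
          (by simp only [true_iff]; exact ⟨i, hi1, rfl, hEi⟩)
        refine ⟨k + 1, .pass d (notMem_of i h fun hV => ?_) hEi hk⟩
        obtain ⟨j, hj, rfl, -, h2⟩ := vStruct_at i h hV
        exact hE.asymm hEi h2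
      · have hEi' : E l[i + 1] l[i] := (hch' i hi1).resolve_left hEi
        obtain ⟨k, hk⟩ := ih (i + 1) hi1 (by omega) false (by
          simp only [Bool.false_eq_true, false_iff]
          rintro ⟨j, hj, hj', h1⟩
          obtain rfl : i = j := by omega
          exact hEi h1)
        cases d with
        | false =>
          refine ⟨k + 1, .climb (notMem_of i h fun hV => ?_) hEi' hk⟩
          obtain ⟨j, hj, rfl, h1, -⟩ := vStruct_at i h hV
          exact Bool.false_ne_true (hd.2 ⟨j, by omega, rfl, h1⟩)
        | true =>
          obtain ⟨j, hj, rfl, h1⟩ := hd.1 rfl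
          obtain ⟨a, ha⟩ := descent_of (j + 1) h (vStruct_iff.2 ⟨j, by omega, rfl, h1, hEi'⟩)
          exact ⟨k + 1 + a, .turn ha hEi' hk⟩
  refine ⟨?_, ?_, ?_⟩
  · rw [← hs']
    refine notMem_of 0 hpos fun hV => ?_
    obtain ⟨j, hj, h, -⟩ := vStruct_at 0 hpos hV
    omega
  · rw [← ht']
    refine notMem_of _ (by omega) fun hV => ?_
    obtain ⟨j, hj, h, -⟩ := vStruct_at _ (by omega) hV
    omega
  · rw [← hs']
    refine main (l.length - 1) 0 hpos (by omega) false ?_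
    simp

theorem VStruct.reverse {l : List V} {u : V} (h : VStruct E l u) : VStruct E l.reverse u := by
  obtain ⟨l₁, l₂, a, b, rfl, h1, h2⟩ := h
  exact ⟨l₂.reverse, l₁.reverse, b, a, by simp, h2, h1⟩

theorem vStruct_reverse_iff {l : List V} {u : V} : VStruct E l.reverse u ↔ VStruct E l u :=
  ⟨fun h => by simpa using h.reverse, VStruct.reverse⟩

theorem IsTrail.reverse {l : List V} (h : IsTrail E l) : IsTrail E l.reverse := by
  refine ⟨by simpa using h.1, by simpa using h.2.1, ?_⟩
  refine List.isChain_reverse.2 (List.IsChain.imp ?_ h.2.2)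
  intro a b hab
  exact hab.symm

theorem DSep.not_activeTo {A B : Set V} (hE : IsDAG E) (h : DSep E A B S) {a b : V} (ha : a ∈ A)
    (hb : b ∈ B) (haS : a ∉ S) (k : ℕ) : ¬ ActiveTo E S a k b false := by
  intro hk
  obtain ⟨n, v, d, r, hw, hv, hd⟩ := exists_shortestWalk ⟨k, hk⟩
  obtain ⟨l, hl, hhead, hlast, hnb⟩ := hw.exists_trail hE haS hd
  obtain ⟨u, hu, hblock⟩ := h l.reverse a b hl.reverse (by simpa using hlast)
    (by simpa [hv] using hhead) ha hb
  rw [vStruct_reverse_iff] at hblock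
  exact hnb ⟨u, by simpa using hu, hblock⟩

/-- If `{s}` is d-separated from `B` given `S`, then the set `R` of nodes actively connected to
`s` splits the families of the ancestors of `{s} ∪ B`. -/
theorem DSep.exists_split {s : V} {B : Set V} (hE : IsDAG E) (h : DSep E {s} B S) (hs : s ∉ S) :
    ∃ R : Set V, s ∈ R ∧ (∀ x ∈ R, x ∉ S) ∧ (∀ x ∈ R, x ∉ B) ∧
      ∀ u, (∃ b, (b = s ∨ b ∈ B) ∧ Relation.ReflTransGen E u b) →
        ∀ a b, (a = u ∨ E a u) → (b = u ∨ E b u) → a ∈ R → b ∉ S → b ∈ R := by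
  have hno : ∀ b ∈ B, ∀ k, ¬ ActiveTo E S s k b false := fun b hb =>
    h.not_activeTo hE rfl hb hs
  have climb : ∀ {u b : V}, Relation.ReflTransGen E u b → (∀ a, ¬ Descent E S a u) →
      (∃ k, ActiveTo E S s k u false) → ∃ k, ActiveTo E S s k b false := by
    intro u b hub hu hk
    have : (∃ k, ActiveTo E S s k b false) ∧ ∃ m, DirPath E S u m b := by
      induction hub with
      | refl => exact ⟨hk, 0, .refl⟩
      | @tail x y hux hxy ih =>
        obtain ⟨⟨k, hk⟩, m, hm⟩ := ih
        have hxS : x ∉ S := fun hxS => by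
          obtain ⟨a, ha⟩ := exists_descent_of_reflTransGen hux hxS
          exact hu a ha
        have hyS : y ∉ S := fun hyS => by
          obtain ⟨a, ha⟩ := exists_descent_of_reflTransGen (hux.tail hxy) hyS
          exact hu a ha
        exact ⟨⟨k + 1, .climb hyS hxy hk⟩, m + 1, .snoc hm hxS hxy⟩
    exact this.1
  have descend : ∀ {u : V}, Relation.ReflTransGen E u s → (∀ a, ¬ Descent E S a u) →
      ∃ k, ActiveTo E S s k u true := by
    intro u hus hu
    induction hus using Relation.ReflTransGen.head_induction_on with
    | refl => exact ⟨0, .done _⟩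
    | @head x y hxy _ ih =>
      have hxS : x ∉ S := fun hxS => hu 0 (.mem hxS)
      obtain ⟨k, hk⟩ := ih fun a ha => hu (a + 1) (.step hxS hxy ha)
      exact ⟨k + 1, .pass _ hxS hxy hk⟩
  have down : ∀ u, (∃ b, (b = s ∨ b ∈ B) ∧ Relation.ReflTransGen E u b) →
      (∃ k, ActiveTo E S s k u false) → ∃ k, ActiveTo E S s k u true := by
    rintro u ⟨b, hb, hub⟩ hk
    by_cases hd : ∃ a, Descent E S a u
    · obtain ⟨a, ha⟩ := hd
      obtain ⟨k, hk⟩ := hk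
      obtain ⟨k', -, hk'⟩ := hk.true_of_false ha
      exact ⟨k', hk'⟩
    · rw [not_exists] at hd
      rcases hb with rfl | hb
      · exact descend hub hd
      · obtain ⟨k, hk⟩ := climb hub hd hk
        exact absurd hk (hno b hb k)
  refine ⟨{x | x ∉ S ∧ ∃ k, ActiveTo E S s k x false}, ⟨hs, 0, .done _⟩, fun x hx => hx.1,
    fun x hx hxB => ?_, ?_⟩
  · obtain ⟨-, k, hk⟩ := hx
    exact hno x hxB k hk
  · rintro u hu a b ha hb ⟨haS, k, hk⟩ hbS
    refine ⟨hbS, ?_⟩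
    have fromTop : (∃ k, ActiveTo E S s k u true) → E b u → ∃ k, ActiveTo E S s k b false := by
      rintro ⟨k, hk⟩ hbu
      exact ⟨k + 1, .pass _ hbS hbu hk⟩
    rcases ha with rfl | hau
    · rcases hb with rfl | hba
      · exact ⟨k, hk⟩
      · exact fromTop (down a hu ⟨k, hk⟩) hba
    · by_cases huS : u ∈ S
      · rcases hb with rfl | hbu
        · exact absurd huS hbS
        · exact fromTop ⟨_, .turn (.mem huS) hau hk⟩ hbu
      · have hu' : ActiveTo E S s (k + 1) u false := .climb huS hau hk
        rcases hb with rfl | hbu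
        · exact ⟨_, hu'⟩
        · exact fromTop (down u hu ⟨_, hu'⟩) hbu

end ActiveWalks

section Kernels

theorem IsDAG.irrefl {V : Type*} {E : V → V → Prop} (hE : IsDAG E) (v : V) : ¬ E v v :=
  fun h => hE v (.single h)

theorem IsDAG.exists_sink {V : Type*} [Finite V] {E : V → V → Prop} (hE : IsDAG E)
    {D : Finset V} (hD : D.Nonempty) :
    ∃ v ∈ D, ∀ w ∈ D, ¬ E v w := by
  let r : V → V → Prop := fun a b => Relation.TransGen E b a
  have : IsTrans V r := ⟨fun _ _ _ hab hbc => hbc.trans hab⟩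
  have : Std.Irrefl r := ⟨hE⟩
  obtain ⟨v, hv, hmin⟩ := (Finite.wellFounded_of_trans_of_irrefl r).has_min (D : Set V) hD
  exact ⟨v, hv, fun w hw hvw => hmin w hw (.single hvw)⟩

theorem IsKernel.congr {V : Type*} {X : V → Type*} [∀ v, Fintype (X v)]
    {E : V → V → Prop} {u : V} {k : X u → (∀ v, X v) → ℝ} (hk : IsKernel X E u k)
    {x y : ∀ v, X v} (h : ∀ t, t = u ∨ E t u → x t = y t) : k (x u) x = k (y u) y := by
  rw [h u (Or.inl rfl)]
  exact hk.2.1 _ _ _ fun t ht => h t (Or.inr ht)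

variable {V : Type*} [Fintype V] [DecidableEq V] {X : V → Type*} [∀ v, Fintype (X v)]
variable {E : V → V → Prop}

theorem sum_sum_update (v : V) (H : (∀ v, X v) → ℝ) :
    ∑ x, ∑ a, H (Function.update x v a) = Fintype.card (X v) * ∑ x, H x := by
  let e : (∀ v, X v) × X v → (∀ v, X v) × X v := fun q => (Function.update q.1 v q.2, q.1 v)
  have he : Function.Involutive e := fun q => by simp [e]
  rw [← Fintype.sum_prod_type' (fun x a => H (Function.update x v a)),
    Fintype.sum_equiv he.toPerm (fun q => H (Function.update q.1 v q.2)) (fun q => H q.1)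
      fun _ => rfl, Fintype.sum_prod_type]
  simp [Finset.mul_sum]

theorem sum_mul_kernel (hE : IsDAG E) {v : V} {k : X v → (∀ v, X v) → ℝ} (hk : IsKernel X E v k)
    (F : (∀ v, X v) → ℝ) (hF : ∀ x a, F (Function.update x v a) = F x) :
    Fintype.card (X v) * ∑ x, F x * k (x v) x = ∑ x, F x := by
  rw [← sum_sum_update]
  refine Finset.sum_congr rfl fun x _ => ?_
  have : ∀ a, F (Function.update x v a) *
      k (Function.update x v a v) (Function.update x v a) = F x * k a x := by
    intro a
    rw [hF, Function.update_self, hk.2.1 a _ x]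
    intro t ht
    rw [Function.update_of_ne]
    rintro rfl
    exact hE.irrefl _ ht
  simp only [this]
  rw [← Finset.mul_sum, hk.2.2, mul_one]

/-- Kernels of the nodes in `D` can be summed out against functions not depending on `D`. -/
theorem sum_mul_prod_kernel (hE : IsDAG E) {k : ∀ s, X s → (∀ v, X v) → ℝ}
    (hk : ∀ s, IsKernel X E s (k s)) (D : Finset V) (F : (∀ v, X v) → ℝ)
    (hF : ∀ v ∈ D, ∀ x a, F (Function.update x v a) = F x) :
    (∏ u ∈ D, (Fintype.card (X u) : ℝ)) * ∑ x, F x * ∏ u ∈ D, k u (x u) x = ∑ x, F x := by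
  induction D using Finset.strongInduction with
  | H D ih =>
    rcases D.eq_empty_or_nonempty with rfl | hD
    · simp
    obtain ⟨v, hv, hsink⟩ := hE.exists_sink hD
    have hG : ∀ x a, F (Function.update x v a) * ∏ u ∈ D.erase v,
        k u (Function.update x v a u) (Function.update x v a) =
        F x * ∏ u ∈ D.erase v, k u (x u) x := by
      intro x a
      rw [hF v hv]
      congr 1
      refine Finset.prod_congr rfl fun u hu => (hk u).congr fun t ht => ?_
      rw [Function.update_of_ne]
      rintro rfl
      rcases ht with rfl | ht
      · simp at hu
      · exact hsink u (Finset.mem_of_mem_erase hu) ht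
    have h1 := sum_mul_kernel hE (hk v) (fun x => F x * ∏ u ∈ D.erase v, k u (x u) x) hG
    have h2 := ih (D.erase v) (Finset.erase_ssubset hv)
      fun w hw => hF w (Finset.mem_of_mem_erase hw)
    rw [← h2, ← h1, ← Finset.mul_prod_erase D (fun u => (Fintype.card (X u) : ℝ)) hv]
    have h3 : ∀ x, F x * ∏ u ∈ D, k u (x u) x =
        F x * (∏ u ∈ D.erase v, k u (x u) x) * k v (x v) x := by
      intro x
      rw [← Finset.mul_prod_erase D (fun u => k u (x u) x) hv]
      ring
    simp only [h3]
    ring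

theorem Factorizes.isPMF (hE : IsDAG E) [∀ v, Nonempty (X v)] {p : (∀ v, X v) → ℝ}
    (hp : Factorizes X E p) : IsPMF X p := by
  obtain ⟨k, hk, hpk⟩ := hp
  refine ⟨fun x => ?_, ?_⟩
  · rw [hpk]
    exact Finset.prod_nonneg fun u _ => (hk u).1 _ _
  · have h := sum_mul_prod_kernel hE hk Finset.univ (fun _ => 1) fun _ _ _ _ => rfl
    simp only [one_mul, ← hpk, Finset.sum_const, Finset.card_univ, Fintype.card_pi,
      nsmul_eq_mul, mul_one, Nat.cast_prod] at h
    have h0 : (∏ u, (Fintype.card (X u) : ℝ)) ≠ 0 :=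
      Finset.prod_ne_zero_iff.2 fun u _ => Nat.cast_ne_zero.2 Fintype.card_ne_zero
    exact mul_left_cancel₀ h0 (by rw [h, mul_one])

/-- Local nonempty constraints are the support condition of some factorizing distribution. -/
theorem exists_factorizes_support (hE : IsDAG E) [∀ v, Nonempty (X v)]
    (allowed : ∀ u, X u → (∀ v, X v) → Prop)
    (hdep : ∀ u a x y, (∀ t, E t u → x t = y t) → (allowed u a x ↔ allowed u a y))
    (hne : ∀ u x, ∃ a, allowed u a x) :
    ∃ p, IsPMF X p ∧ Factorizes X E p ∧ ∀ x, 0 < p x ↔ ∀ u, allowed u (x u) x := by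
  classical
  let N : ∀ u, (∀ v, X v) → ℝ := fun u x => ∑ a, if allowed u a x then 1 else 0
  let k : ∀ u, X u → (∀ v, X v) → ℝ := fun u a x => (if allowed u a x then 1 else 0) / N u x
  have hN : ∀ u x, 0 < N u x := by
    intro u x
    obtain ⟨a, ha⟩ := hne u x
    refine Finset.sum_pos' (fun b _ => by positivity) ⟨a, Finset.mem_univ _, ?_⟩
    simp [ha]
  have hk : ∀ u, IsKernel X E u (k u) := by
    intro u
    refine ⟨fun a x => div_nonneg (by positivity) (hN u x).le, fun a x y h => ?_, fun x => ?_⟩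
    · simp only [k, N, hdep u _ x y h]
    · simp only [k]
      rw [← Finset.sum_div]
      exact div_self (hN u x).ne'
  have hpos : ∀ u a x, 0 < k u a x ↔ allowed u a x := by
    intro u a x
    by_cases h : allowed u a x
    · simp [k, h, hN u x]
    · simp [k, h]
  have hfac : Factorizes X E fun x => ∏ u, k u (x u) x := ⟨k, hk, fun _ => rfl⟩
  refine ⟨_, hfac.isPMF hE, hfac, fun x => ⟨fun h u => ?_, fun h => ?_⟩⟩
  · rw [← hpos]
    refine lt_of_le_of_ne ((hk u).1 _ _) fun h0 => h.ne' ?_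
    exact Finset.prod_eq_zero (Finset.mem_univ u) h0.symm
  · exact Finset.prod_pos fun u _ => (hpos _ _ _).2 (h u)

/-- A configuration all of whose kernels are positive up to the node `s` extends, beyond `s` in a
topological ordering, to one with all kernels positive. -/
theorem IsTopo.exists_pos_extension {O : V → Fin (Fintype.card V)} (hO : IsTopo E O)
    {k : ∀ s, X s → (∀ v, X v) → ℝ} (hk : ∀ s, IsKernel X E s (k s)) {s : V} {x : ∀ v, X v}
    (hx : ∀ u, O u ≤ O s → 0 < k u (x u) x) :
    ∃ y, (∀ u, O u ≤ O s → y u = x u) ∧ ∀ u, 0 < k u (y u) y := by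
  have main : ∀ m : ℕ, ∃ y, (∀ u, O u ≤ O s → y u = x u) ∧
      ∀ u, (O u ≤ O s ∨ (O u : ℕ) < m) → 0 < k u (y u) y := by
    intro m
    induction m with
    | zero => exact ⟨x, fun _ _ => rfl, fun u hu => hx u (hu.resolve_right (Nat.not_lt_zero _))⟩
    | succ m ih =>
      obtain ⟨y, hy, hpos⟩ := ih
      by_cases hm : ∃ w, (O w : ℕ) = m ∧ ¬ O w ≤ O s
      · obtain ⟨w, hw, hws⟩ := hm
        obtain ⟨a, -, ha⟩ : ∃ a ∈ Finset.univ, 0 < k w a y :=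
          (Finset.sum_pos_iff_of_nonneg fun a _ => (hk w).1 a y).1
            (by rw [(hk w).2.2 y]; exact one_pos)
        refine ⟨Function.update y w a, fun u hu => ?_, fun u hu => ?_⟩
        · rw [Function.update_of_ne, hy u hu]
          rintro rfl
          exact hws hu
        · by_cases huw : u = w
          · subst huw
            rw [Function.update_self, (hk u).2.1 a _ y]
            · exact ha
            · intro t ht
              rw [Function.update_of_ne]
              rintro rfl
              exact lt_irrefl _ (hO.2 _ _ ht)
          · have hlt : O u ≤ O s ∨ (O u : ℕ) < m := by
              refine hu.imp_right fun h => lt_of_le_of_ne (Nat.lt_succ_iff.1 h) fun h' => huw ?_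
              exact hO.1 (Fin.ext (h'.trans hw.symm))
            rw [(hk u).congr (y := y)]
            · exact hpos u hlt
            · intro t ht
              rw [Function.update_of_ne]
              rintro rfl
              rcases ht with rfl | ht
              · exact huw rfl
              · have h1 := hO.2 _ _ ht
                rcases hlt with h | h
                · exact hws (h1.le.trans h)
                · rw [Fin.lt_def] at h1
                  omega
      · refine ⟨y, hy, fun u hu => hpos u ?_⟩
        by_contra h
        rw [not_or] at h
        exact hm ⟨u, by have := hu.resolve_left h.1; omega, h.1⟩
  obtain ⟨y, hy, hpos⟩ := main (Fintype.card V)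
  exact ⟨y, hy, fun u => hpos u (Or.inr (O u).2)⟩

variable [∀ v, DecidableEq (X v)]

theorem marg_congr (p : (∀ v, X v) → ℝ) {C : Finset V} {x y : ∀ v, X v}
    (h : ∀ v ∈ C, x v = y v) : marg X p C x = marg X p C y := by
  refine Finset.sum_congr rfl fun z _ => ?_
  have : (∀ v ∈ C, z v = x v) ↔ ∀ v ∈ C, z v = y v :=
    forall₂_congr fun v hv => by rw [h v hv]
  simp only [this]

theorem marg_nonneg {p : (∀ v, X v) → ℝ} (hp : ∀ x, 0 ≤ p x) (C : Finset V) (x : ∀ v, X v) :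
    0 ≤ marg X p C x :=
  Finset.sum_nonneg fun y _ => by
    split_ifs
    · exact hp y
    · exact le_rfl

theorem marg_anti {p : (∀ v, X v) → ℝ} (hp : ∀ x, 0 ≤ p x) {C D : Finset V} (h : C ⊆ D)
    (x : ∀ v, X v) : marg X p D x ≤ marg X p C x := by
  refine Finset.sum_le_sum fun y _ => ?_
  by_cases hD : ∀ v ∈ D, y v = x v
  · rw [if_pos hD, if_pos fun v hv => hD v (h hv)]
  · rw [if_neg hD]
    split_ifs
    · exact hp y
    · exact le_rfl

theorem marg_univ (p : (∀ v, X v) → ℝ) (x : ∀ v, X v) : marg X p Finset.univ x = p x := by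
  have : ∀ y : ∀ v, X v, (∀ v ∈ Finset.univ, y v = x v) ↔ y = x := fun y => by
    simp [funext_iff]
  simp only [marg, this]
  simp

theorem sum_marg_insert_update (p : (∀ v, X v) → ℝ) {C : Finset V} {s : V} (hs : s ∉ C)
    (x : ∀ v, X v) : ∑ a, marg X p (insert s C) (Function.update x s a) = marg X p C x := by
  unfold marg
  rw [Finset.sum_comm]
  refine Finset.sum_congr rfl fun y _ => ?_
  have : ∀ a, (∀ v ∈ insert s C, y v = Function.update x s a v) ↔
      (y s = a ∧ ∀ v ∈ C, y v = x v) := by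
    intro a
    rw [Finset.forall_mem_insert, Function.update_self]
    refine and_congr_right fun _ => forall₂_congr fun v hv => ?_
    rw [Function.update_of_ne]
    rintro rfl
    exact hs hv
  simp only [this, ite_and]
  simp

theorem marg_mul_marg_of_eq_mul {p f g : (∀ v, X v) → ℝ} (hp : ∀ x, p x = f x * g x)
    {R : Set V} {s : V} {B S : Finset V} (hs : s ∈ R) (hSB : S ⊆ B) (hB : ∀ v ∈ R, v ∉ B)
    (hf : ∀ x y, (∀ v, v ∈ R ∨ v ∈ S → x v = y v) → f x = f y)
    (hg : ∀ x y, (∀ v, v ∉ R → x v = y v) → g x = g y) (x : ∀ v, X v) :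
    marg X p (insert s B) x * marg X p S x = marg X p (insert s S) x * marg X p B x := by
  classical
  let mix : (∀ v, X v) → (∀ v, X v) → ∀ v, X v := fun y z v => if v ∈ R then y v else z v
  let e : (∀ v, X v) × (∀ v, X v) → (∀ v, X v) × (∀ v, X v) :=
    fun q => (mix q.1 q.2, mix q.2 q.1)
  have he : Function.Involutive e := by
    rintro ⟨y, z⟩
    refine Prod.ext (funext fun v => ?_) (funext fun v => ?_) <;> by_cases hv : v ∈ R <;>
      simp [e, mix, hv]
  have mixR : ∀ y z v, v ∈ R → mix y z v = y v := fun y z v hv => if_pos hv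
  have mixR' : ∀ y z v, v ∉ R → mix y z v = z v := fun y z v hv => if_neg hv
  have hBR : ∀ v ∈ B, v ∉ R := fun v hv hR => hB v hR hv
  unfold marg
  rw [Finset.sum_mul_sum, Finset.sum_mul_sum, ← Fintype.sum_prod_type', ← Fintype.sum_prod_type']
  refine Fintype.sum_equiv he.toPerm _ _ ?_
  rintro ⟨y, z⟩
  change (if ∀ v ∈ insert s B, y v = x v then p y else 0) *
      (if ∀ v ∈ S, z v = x v then p z else 0) =
    (if ∀ v ∈ insert s S, mix y z v = x v then p (mix y z) else 0) *
      (if ∀ v ∈ B, mix z y v = x v then p (mix z y) else 0)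
  have hiff : ((∀ v ∈ insert s B, y v = x v) ∧ ∀ v ∈ S, z v = x v) ↔
      (∀ v ∈ insert s S, mix y z v = x v) ∧ ∀ v ∈ B, mix z y v = x v := by
    rw [Finset.forall_mem_insert, Finset.forall_mem_insert, mixR _ _ _ hs]
    have h1 : (∀ v ∈ S, mix y z v = x v) ↔ ∀ v ∈ S, z v = x v :=
      forall₂_congr fun v hv => by rw [mixR' _ _ _ (hBR v (hSB hv))]
    have h2 : (∀ v ∈ B, mix z y v = x v) ↔ ∀ v ∈ B, y v = x v :=
      forall₂_congr fun v hv => by rw [mixR' _ _ _ (hBR v hv)]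
    rw [h1, h2]
    tauto
  by_cases h : (∀ v ∈ insert s B, y v = x v) ∧ ∀ v ∈ S, z v = x v
  · have h' := hiff.1 h
    rw [if_pos h.1, if_pos h.2, if_pos h'.1, if_pos h'.2, hp, hp, hp, hp]
    have hyz : ∀ v ∈ S, y v = z v := fun v hv => by
      rw [h.2 v hv, h.1 v (Finset.mem_insert_of_mem (hSB hv))]
    have f1 : f (mix y z) = f y := hf _ _ fun v hv => by
      by_cases hR : v ∈ R
      · exact mixR _ _ _ hR
      · rw [mixR' _ _ _ hR, hyz v (hv.resolve_left hR)]
    have f2 : f (mix z y) = f z := hf _ _ fun v hv => by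
      by_cases hR : v ∈ R
      · exact mixR _ _ _ hR
      · rw [mixR' _ _ _ hR, hyz v (hv.resolve_left hR)]
    rw [f1, f2, hg (mix y z) z fun v hv => mixR' _ _ _ hv,
      hg (mix z y) y fun v hv => mixR' _ _ _ hv]
    ring
  · have h' := mt hiff.2 h
    rw [ite_zero_mul_ite_zero, ite_zero_mul_ite_zero, if_neg h, if_neg h']

theorem marg_eq_marg_prod (hE : IsDAG E) {k : ∀ s, X s → (∀ v, X v) → ℝ}
    (hk : ∀ s, IsKernel X E s (k s)) {p : (∀ v, X v) → ℝ} (hp : ∀ x, p x = ∏ s, k s (x s) x)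
    {A C : Finset V} (hA : ∀ u ∈ A, ∀ t, E t u → t ∈ A) (hC : C ⊆ A) (x : ∀ v, X v) :
    (∏ u ∈ Aᶜ, (Fintype.card (X u) : ℝ)) * marg X p C x =
      marg X (fun y => ∏ u ∈ A, k u (y u) y) C x := by
  unfold marg
  rw [← sum_mul_prod_kernel hE hk Aᶜ
    fun y => if ∀ v ∈ C, y v = x v then ∏ u ∈ A, k u (y u) y else 0]
  · congr 1
    refine Finset.sum_congr rfl fun y _ => ?_
    split_ifs
    · rw [hp, Finset.prod_mul_prod_compl]
    · rw [zero_mul]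
  · intro v hv y a
    rw [Finset.mem_compl] at hv
    have hne : ∀ t ∈ A, Function.update y v a t = y t := fun t ht => by
      rw [Function.update_of_ne]
      rintro rfl
      exact hv ht
    have h1 : (∀ t ∈ C, Function.update y v a t = x t) ↔ ∀ t ∈ C, y t = x t :=
      forall₂_congr fun t ht => by rw [hne t (hC ht)]
    have h2 : ∏ u ∈ A, k u (Function.update y v a u) (Function.update y v a) =
        ∏ u ∈ A, k u (y u) y := by
      refine Finset.prod_congr rfl fun u hu => (hk u).congr fun t ht => hne t ?_
      rcases ht with rfl | ht
      · exact hu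
      · exact hA u hu t ht
    simp only [h1, h2]

/-- Soundness of d-separation of a node from a set given a subset of it. -/
theorem marg_mul_marg_of_dSep (hE : IsDAG E) [∀ v, Nonempty (X v)] {p : (∀ v, X v) → ℝ}
    (hp : Factorizes X E p) {s : V} {B S : Finset V} (hs : s ∉ B) (hSB : S ⊆ B)
    (hd : DSep E {s} B S) (x : ∀ v, X v) :
    marg X p (insert s B) x * marg X p S x = marg X p (insert s S) x * marg X p B x := by
  classical
  obtain ⟨k, hk, hpk⟩ := hp
  obtain ⟨R, hsR, hRS, hRB, hR⟩ := hd.exists_split hE fun h => hs (hSB h)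
  let A : Finset V := Finset.univ.filter fun u =>
    ∃ b, (b = s ∨ b ∈ B) ∧ Relation.ReflTransGen E u b
  have hA : ∀ u ∈ A, ∀ t, E t u → t ∈ A := by
    intro u hu t ht
    obtain ⟨b, hb, hub⟩ := (Finset.mem_filter.1 hu).2
    exact Finset.mem_filter.2 ⟨Finset.mem_univ _, b, hb, .head ht hub⟩
  have hsA : s ∈ A := Finset.mem_filter.2 ⟨Finset.mem_univ _, s, Or.inl rfl, .refl⟩
  have hBA : B ⊆ A := fun b hb =>
    Finset.mem_filter.2 ⟨Finset.mem_univ _, b, Or.inr hb, .refl⟩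
  let q : V → Prop := fun u => ∃ a, (a = u ∨ E a u) ∧ a ∈ R
  have key := marg_mul_marg_of_eq_mul (X := X) (p := fun y => ∏ u ∈ A, k u (y u) y)
    (f := fun y => ∏ u ∈ A.filter q, k u (y u) y)
    (g := fun y => ∏ u ∈ A.filter fun u => ¬ q u, k u (y u) y)
    (fun y => (Finset.prod_filter_mul_prod_filter_not A q _).symm) hsR hSB hRB
    (fun y z h => Finset.prod_congr rfl fun u hu => (hk u).congr fun t ht => ?_)
    (fun y z h => Finset.prod_congr rfl fun u hu => (hk u).congr fun t ht => ?_) x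
  · rw [← marg_eq_marg_prod hE hk hpk hA (Finset.insert_subset hsA hBA),
      ← marg_eq_marg_prod hE hk hpk hA (hSB.trans hBA),
      ← marg_eq_marg_prod hE hk hpk hA (Finset.insert_subset hsA (hSB.trans hBA)),
      ← marg_eq_marg_prod hE hk hpk hA hBA] at key
    have h0 : (∏ u ∈ Aᶜ, (Fintype.card (X u) : ℝ)) ≠ 0 :=
      Finset.prod_ne_zero_iff.2 fun u _ => Nat.cast_ne_zero.2 Fintype.card_ne_zero
    refine mul_left_cancel₀ (mul_ne_zero h0 h0) ?_
    linear_combination key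
  · obtain ⟨huA, a, ha, haR⟩ := Finset.mem_filter.1 hu
    refine h t ?_
    by_cases htS : t ∈ S
    · exact Or.inr htS
    · exact Or.inl (hR u (Finset.mem_filter.1 huA).2 a t ha ht haR htS)
  · refine h t fun htR => ?_
    exact (Finset.mem_filter.1 hu).2 ⟨t, ht, htR⟩

/-- The ordered Markov property implies factorization. -/
theorem factorizes_of_marg_mul_marg {O : V → Fin (Fintype.card V)} (hO : IsTopo E O)
    [∀ v, Nonempty (X v)] {p : (∀ v, X v) → ℝ} (hp : IsPMF X p) (pa pr : V → Finset V)
    (hpa : ∀ s t, t ∈ pa s ↔ E t s) (hpr : ∀ s t, t ∈ pr s ↔ O t < O s)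
    (h : ∀ s x, marg X p (insert s (pr s)) x * marg X p (pa s) x =
      marg X p (insert s (pa s)) x * marg X p (pr s) x) : Factorizes X E p := by
  have hspa : ∀ s, s ∉ pa s := fun s hs => lt_irrefl _ (hO.2 s s ((hpa s s).1 hs))
  have hspr : ∀ s, s ∉ pr s := fun s hs => lt_irrefl _ ((hpr s s).1 hs)
  have hsub : ∀ s, pa s ⊆ pr s := fun s t ht => (hpr s t).2 (hO.2 t s ((hpa s t).1 ht))
  let k : ∀ s, X s → (∀ v, X v) → ℝ := fun s a x =>
    if marg X p (pa s) x = 0 then (Fintype.card (X s) : ℝ)⁻¹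
    else marg X p (insert s (pa s)) (Function.update x s a) / marg X p (pa s) x
  have hk : ∀ s, IsKernel X E s (k s) := by
    intro s
    refine ⟨fun a x => ?_, fun a x y hxy => ?_, fun x => ?_⟩
    · simp only [k]
      split_ifs
      · positivity
      · exact div_nonneg (marg_nonneg hp.1 _ _) (marg_nonneg hp.1 _ _)
    · have h1 : marg X p (pa s) x = marg X p (pa s) y :=
        marg_congr p fun t ht => hxy t ((hpa s t).1 ht)
      have h2 : marg X p (insert s (pa s)) (Function.update x s a) =
          marg X p (insert s (pa s)) (Function.update y s a) := by
        refine marg_congr p fun t ht => ?_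
        rcases Finset.mem_insert.1 ht with rfl | ht
        · simp
        · have hne : t ≠ s := fun e => hspa s (e ▸ ht)
          rw [Function.update_of_ne hne, Function.update_of_ne hne]
          exact hxy t ((hpa s t).1 ht)
      simp only [k, h1, h2]
    · by_cases h0 : marg X p (pa s) x = 0
      · simp [k, h0]
      · simp only [k, if_neg h0]
        rw [← Finset.sum_div, sum_marg_insert_update p (hspa s), div_self h0]
  have step : ∀ s x, marg X p (insert s (pr s)) x = marg X p (pr s) x * k s (x s) x := by
    intro s x
    simp only [k, Function.update_eq_self]
    split_ifs with h0
    · have h1 : marg X p (pr s) x = 0 :=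
        le_antisymm ((marg_anti hp.1 (hsub s) x).trans h0.le) (marg_nonneg hp.1 _ _)
      have h2 : marg X p (insert s (pr s)) x = 0 :=
        le_antisymm ((marg_anti hp.1 (Finset.subset_insert _ _) x).trans h1.le)
          (marg_nonneg hp.1 _ _)
      rw [h1, h2, zero_mul]
    · rw [mul_div_assoc', eq_div_iff h0, h s x, mul_comm]
  have main : ∀ (m : ℕ) x, marg X p (Finset.univ.filter fun u => (O u : ℕ) < m) x =
      ∏ u ∈ Finset.univ.filter fun u => (O u : ℕ) < m, k u (x u) x := by
    intro m x
    induction m with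
    | zero => simp [marg, hp.2]
    | succ m ih =>
      by_cases hm : ∃ s, (O s : ℕ) = m
      · obtain ⟨s, rfl⟩ := hm
        have hpr' : (Finset.univ.filter fun u => (O u : ℕ) < O s) = pr s := by
          ext u
          simp [hpr]
        have hins : (Finset.univ.filter fun u => (O u : ℕ) < O s + 1) = insert s (pr s) := by
          ext u
          simp only [Finset.mem_filter, Finset.mem_univ, true_and, Finset.mem_insert, hpr,
            Nat.lt_succ_iff_lt_or_eq, Fin.lt_def]
          rw [or_comm, Fin.val_inj, hO.1.eq_iff]
        rw [hpr'] at ih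
        rw [hins, step, ih, Finset.prod_insert (hspr s), mul_comm]
      · have : (Finset.univ.filter fun u => (O u : ℕ) < m + 1) =
            Finset.univ.filter fun u => (O u : ℕ) < m := by
          refine Finset.filter_congr fun u _ => ?_
          have : (O u : ℕ) ≠ m := fun e => hm ⟨u, e⟩
          omega
        rw [this, ih]
  refine ⟨k, hk, fun x => ?_⟩
  have huniv : (Finset.univ.filter fun u => (O u : ℕ) < Fintype.card V) = Finset.univ :=
    Finset.filter_true_of_mem fun u _ => (O u).2
  have := main (Fintype.card V) x
  rwa [huniv, marg_univ] at this

end Kernels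

/-- Completeness of d-separation: along an active walk one can build a factorizing distribution
correlating its two ends given `S`. -/
theorem exists_factorizes_of_activeTo {V : Type*} [Fintype V] [DecidableEq V] {X : V → Type*}
    [∀ v, Fintype (X v)] {E : V → V → Prop} {S : Set V} (hE : IsDAG E) {z o : ∀ v, X v}
    (hzo : ∀ v, z v ≠ o v) {s t : V} (ht : t ∉ S) (ha : ∃ k, ActiveTo E S t k s false) :
    ∃ (p : (∀ v, X v) → ℝ) (x : ∀ v, X v), IsPMF X p ∧ Factorizes X E p ∧ 0 < p z ∧ 0 < p x ∧
      (∀ v ∈ S, x v = z v) ∧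
      ∀ y, 0 < p y → (∀ v ∈ S, y v = z v) → y s = z s → y t ≠ x t := by
  classical
  have : ∀ v, Nonempty (X v) := fun v => ⟨z v⟩
  obtain ⟨n, v, d, r, hw, rfl, hd0⟩ := exists_shortestWalk ha
  let col : ℕ → Prop := fun j => j < n ∧ d j = true ∧ d (j + 1) = false
  let Z : Set V := {u | ∃ j ≤ n, ¬ col j ∧ u = v j}
  let TP : V → V → Prop := fun c u => ∃ i < n,
    (c = v i ∧ u = v (i + 1) ∧ d (i + 1) = true) ∨ (c = v (i + 1) ∧ u = v i ∧ d (i + 1) = false)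
  have hZS : ∀ u ∈ S, u ∉ Z := by
    rintro u hu ⟨j, hj, hc, rfl⟩
    exact hw.notMem ht hj hc hu
  have hTPE : ∀ c u, TP c u → E c u := by
    rintro c u ⟨i, hi, ⟨rfl, rfl, h⟩ | ⟨rfl, rfl, h⟩⟩
    · rcases hw.step i hi with h' | h' | ⟨_, h'⟩
      · exact h'.2.1
      · simp_all
      · simp_all
    · rcases hw.step i hi with h' | h' | ⟨_, h'⟩
      · simp_all
      · exact h'.2.1
      · exact h'.2.1
  have hTPZ : ∀ c u, TP c u → c ∈ Z := by
    rintro c u ⟨i, hi, ⟨rfl, rfl, h⟩ | ⟨rfl, rfl, h⟩⟩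
    · exact ⟨i, hi.le, fun hc => by simp [hc.2.2] at h, rfl⟩
    · exact ⟨i + 1, hi, fun hc => by simp [hc.2.1] at h, rfl⟩
  have hTPu : ∀ u ∈ Z, ∀ c c', TP c u → TP c' u → c = c' := by
    rintro u ⟨j, hj, hc, rfl⟩ c c' ⟨i, hi, ⟨rfl, h1, h⟩ | ⟨rfl, h1, h⟩⟩
      ⟨i', hi', ⟨rfl, h1', h'⟩ | ⟨rfl, h1', h'⟩⟩
    · obtain rfl := hw.eq_of_eq hj hi h1
      have := hw.eq_of_eq hj hi' h1'
      obtain rfl : i = i' := by omega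
      rfl
    · obtain rfl := hw.eq_of_eq hj hi h1
      obtain rfl := hw.eq_of_eq hj hi'.le h1'
      exact absurd ⟨hi', h, h'⟩ hc
    · obtain rfl := hw.eq_of_eq hj hi' h1'
      obtain rfl := hw.eq_of_eq hj hi.le h1
      exact absurd ⟨hi, h', h⟩ hc
    · obtain rfl := hw.eq_of_eq hj hi.le h1
      obtain rfl := hw.eq_of_eq hj hi'.le h1'
      rfl
  let gate : V → (∀ v, X v) → Prop := fun u x => (∀ c, c ∉ Z → E c u → x c ≠ o c) ∧
    ∀ c c', TP c u → TP c' u → (x c = o c ↔ x c' = o c')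
  let allowed : ∀ u, X u → (∀ v, X v) → Prop := fun u a x =>
    (u ∈ Z → ∀ c, TP c u → (a = o u ↔ x c = o c)) ∧ (u ∉ Z → (a ≠ o u ↔ gate u x))
  have hcopy : ∀ u a x y, (∀ c, E c u → x c = y c) → allowed u a x → allowed u a y := by
    intro u a x y hxy hx
    have hg : gate u x ↔ gate u y := by
      refine and_congr (forall₃_congr fun c _ hc => by rw [hxy c hc])
        (forall₄_congr fun c c' hc hc' => by rw [hxy c (hTPE _ _ hc), hxy c' (hTPE _ _ hc')])
    exact ⟨fun hu c hc => by rw [← hxy c (hTPE _ _ hc)]; exact hx.1 hu c hc,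
      fun hu => by rw [← hg]; exact hx.2 hu⟩
  obtain ⟨p, hp, hfac, hpos⟩ := exists_factorizes_support hE allowed
    (fun u a x y h => ⟨hcopy u a x y h, hcopy u a y x fun c hc => (h c hc).symm⟩) (by
      intro u x
      by_cases hu : u ∈ Z
      · by_cases hc : ∃ c, TP c u ∧ x c = o c
        · obtain ⟨c, hc, hxc⟩ := hc
          refine ⟨o u, fun _ c' hc' => ?_, fun h => absurd hu h⟩
          obtain rfl := hTPu u hu c c' hc hc'
          simp [hxc]
        · refine ⟨z u, fun _ c hc' => ?_, fun h => absurd hu h⟩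
          exact iff_of_false (hzo u) fun h => hc ⟨c, hc', h⟩
      · by_cases hg : gate u x
        · exact ⟨z u, fun h => absurd h hu, fun _ => iff_of_true (hzo u) hg⟩
        · exact ⟨o u, fun h => absurd h hu, fun _ => iff_of_false (fun h => h rfl) hg⟩)
  have hx1 : ∀ u ∈ Z, (if u ∈ Z then o u else z u) = o u := fun u hu => if_pos hu
  have hx2 : ∀ u, u ∉ Z → (if u ∈ Z then o u else z u) = z u := fun u hu => if_neg hu
  refine ⟨p, fun u => if u ∈ Z then o u else z u, hp, hfac, (hpos _).2 fun u => ⟨?_, ?_⟩,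
    (hpos _).2 fun u => ⟨?_, ?_⟩, fun u hu => hx2 u (hZS u hu), ?_⟩
  · exact fun _ c _ => iff_of_false (hzo u) (hzo c)
  · exact fun _ => iff_of_true (hzo u)
      ⟨fun c _ _ => hzo c, fun c c' _ _ => iff_of_false (hzo c) (hzo c')⟩
  · exact fun hu c hc => iff_of_true (hx1 u hu) (hx1 c (hTPZ _ _ hc))
  · intro hu
    refine iff_of_true ?_ ⟨fun c hc _ => ?_, fun c c' hc hc' => ?_⟩
    · rw [hx2 u hu]
      exact hzo u
    · exact fun h => hzo c ((hx2 c hc).symm.trans h)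
    · exact iff_of_true (hx1 c (hTPZ _ _ hc)) (hx1 c' (hTPZ _ _ hc'))
  intro y hy hyS hys
  have hall := (hpos y).1 hy
  have hdescent : ∀ i, col i → ∀ H, Descent E S H (v i) → r i = r (i + 1) + 1 + H →
      ∀ h x, Descent E S h x → ∀ m, DirPath E S (v i) m x → m + h = H → x ∉ Z ∧ y x ≠ o x := by
    intro i hi H _ hr h x hx
    have hnZ : ∀ h x, Descent E S h x → ∀ m, DirPath E S (v i) m x → m + h = H → x ∉ Z := by
      rintro h x hx m hm hmh ⟨j, hj, hc, rfl⟩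
      exact hw.ne_of_dirPath ht hi.1 hi.2.1 hi.2.2 (by rw [hmh]; exact hr) hm hx hj hc rfl
    induction hx with
    | @mem x hxS =>
      intro m hm hmh
      refine ⟨hZS x hxS, ?_⟩
      rw [hyS x hxS]
      exact hzo x
    | @step h x w hxS hxw hwd ih =>
      intro m hm hmh
      have hxZ := hnZ _ _ (.step hxS hxw hwd) m hm hmh
      obtain ⟨hwZ, hyw⟩ := ih (m + 1) (.snoc hm hxS hxw) (by omega)
      exact ⟨hxZ, (((hall w).2 hwZ).1 hyw).1 x hxZ hxw⟩
  have hcol : ∀ i, col i → v i ∉ Z ∧ y (v i) ≠ o (v i) := by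
    intro i hi
    rcases hw.step i hi.1 with h | h | ⟨H, hH, -, -, -, hr⟩
    · have := hi.2.2
      simp_all
    · have := hi.2.1
      simp_all
    · exact hdescent i hi H hH hr H (v i) hH 0 .refl (by omega)
  have hprop : ∀ j ≤ n, ¬ col j → (y (v j) = o (v j) ↔ y (v 0) = o (v 0)) := by
    intro j
    induction j using Nat.strong_induction_on with
    | _ j ih =>
      intro hj hc
      obtain _ | j := j
      · exact Iff.rfl
      have hjZ : v (j + 1) ∈ Z := ⟨_, hj, hc, rfl⟩
      by_cases hcj : col j
      · obtain _ | i := j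
        · simp [col, hd0] at hcj
        have hci : ¬ col i := fun h => by
          have := h.2.2
          simp [hcj.2.1] at this
        rw [← ih i (by omega) (by omega) hci]
        obtain ⟨hZ, hy⟩ := hcol _ hcj
        exact (((hall _).2 hZ).1 hy).2 _ _ ⟨i + 1, by omega, Or.inr ⟨rfl, rfl, hcj.2.2⟩⟩
          ⟨i, by omega, Or.inl ⟨rfl, rfl, hcj.2.1⟩⟩
      · rw [← ih j (by omega) (by omega) hcj]
        cases hd : d (j + 1) with
        | true => exact (hall _).1 hjZ _ ⟨j, by omega, Or.inl ⟨rfl, rfl, hd⟩⟩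
        | false =>
          exact ((hall _).1 ⟨j, by omega, hcj, rfl⟩ _ ⟨j, by omega, Or.inr ⟨rfl, rfl, hd⟩⟩).symm
  have hn : ¬ col n := fun h => lt_irrefl _ h.1
  have htZ : t ∈ Z := ⟨n, le_rfl, hn, hw.last.symm⟩
  have := hprop n le_rfl hn
  rw [hw.last, hys] at this
  intro hyt
  exact hzo _ (this.1 (hyt.trans (hx1 t htZ)))

/-- `P^{G'} ⊇ P^G` iff for every node `s`, `s` is d-separated in `G` from its
predecessors w.r.t. a topological ordering `O'` of `G'` given its parents in `G'`. -/
theorem stmt8 {V : Type*} [Fintype V] [DecidableEq V] [Nonempty V]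
    (X : V → Type*) [∀ v, Fintype (X v)] (h2 : ∀ v, 1 < Fintype.card (X v))
    (E E' : V → V → Prop) (hE : IsDAG E) (hE' : IsDAG E')
    (O' : V → Fin (Fintype.card V)) (hO' : IsTopo E' O') :
    (∀ p : (∀ v, X v) → ℝ, IsPMF X p → Factorizes X E p → Factorizes X E' p) ↔
    (∀ s : V, DSep E {s} {t | O' t < O' s} (paG E' s)) := by
  classical
  have hX : ∀ v, Nonempty (X v) := fun v => Fintype.card_pos_iff.1 (by have := h2 v; omega)
  constructor
  · intro h s l a b hl hla hlb has hb
    obtain rfl : a = s := has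
    by_contra hnb
    obtain ⟨-, hbS, ha⟩ := exists_activeTo_of_trail hE hl hnb hla hlb
    choose z o hzo using fun v => Fintype.one_lt_card_iff.1 (h2 v)
    obtain ⟨p, x, hp, hfac, hz, hx, hxS, hy⟩ := exists_factorizes_of_activeTo hE hzo hbS ha
    obtain ⟨k, hk, hpk⟩ := h p hp hfac
    have hpos : ∀ y, 0 < p y → ∀ u, 0 < k u (y u) y := fun y hy u =>
      ((hk u).1 _ _).lt_of_ne fun h0 => hy.ne' <| by
        rw [hpk]
        exact Finset.prod_eq_zero (Finset.mem_univ u) h0.symm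
    obtain ⟨w, hlt, hge⟩ : ∃ w : ∀ v, X v, (∀ u, O' u < O' a → w u = x u) ∧
        ∀ u, ¬ O' u < O' a → w u = z u :=
      ⟨fun u => if O' u < O' a then x u else z u, fun u hu => if_pos hu, fun u hu => if_neg hu⟩
    obtain ⟨y, hyw, hyk⟩ := hO'.exists_pos_extension hk (s := a) (x := w) (by
        intro u hu
        rcases hu.lt_or_eq with hu | hu
        · rw [(hk u).congr (y := x)]
          · exact hpos x hx u
          · rintro t (rfl | htu)
            · exact hlt t hu
            · exact hlt t ((hO'.2 t u htu).trans hu)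
        · obtain rfl := hO'.1 hu
          rw [(hk u).congr (y := z)]
          · exact hpos z hz u
          · rintro t (rfl | htu)
            · exact hge t (lt_irrefl _)
            · exact (hlt t (hO'.2 t u htu)).trans (hxS t htu))
    refine hy y ?_ (fun u hu => ?_) ?_ ?_
    · rw [hpk]
      exact Finset.prod_pos fun u _ => hyk u
    · have hua := hO'.2 u a hu
      exact (hyw u hua.le).trans ((hlt u hua).trans (hxS u hu))
    · exact (hyw a le_rfl).trans (hge a (lt_irrefl _))
    · exact (hyw b (le_of_lt hb)).trans (hlt b hb)
  · intro h p hp hfac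
    refine factorizes_of_marg_mul_marg hO' hp (fun s => Finset.univ.filter fun t => E' t s)
      (fun s => Finset.univ.filter fun t => O' t < O' s) (by simp) (by simp) fun s x => ?_
    refine marg_mul_marg_of_dSep hE hfac (by simp) ?_ ?_ x
    · exact fun t ht => by simpa using hO'.2 t s (by simpa using ht)
    · simpa [paG] using h s
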